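/- arXiv:2202.06003 — 7 statements merged into one kernel-verified Lean document; each statement's English description precedes it below -/
import Mathlib

section
/- For every pair of policies π_pl, π_op, every α ∈ [0,1], every horizon N ∈ ℕ, and every trajectory τ = (s_0, …, s_N) ∈ S^{N+1}: P^{π_pl, T^α[π_op]}_N(τ) = P^{π_mix, T}_N(τ); that is, the trajectory distribution induced by the player policy under the perturbed kernel coincides with the trajectory distribution induced by the mixed policy under the original kernel. -/
open Finset

/-- A policy: nonnegative and sums to one over actions at every state. -/
def IsPolicy {S A : Type*} [Fintype A] (π : S → A → ℝ) : Prop :=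
  (∀ s a, 0 ≤ π s a) ∧ ∀ s, ∑ a, π s a = 1

/-- A transition kernel: nonnegative and sums to one over next states. -/
def IsKernel {S A : Type*} [Fintype S] (U : S → A → S → ℝ) : Prop :=
  (∀ s a s', 0 ≤ U s a s') ∧ ∀ s a, ∑ s', U s a s' = 1

/-- An initial distribution over states. -/
def IsDist {S : Type*} [Fintype S] (P0 : S → ℝ) : Prop :=
  (∀ s, 0 ≤ P0 s) ∧ ∑ s, P0 s = 1

/-- The perturbed kernel `T^α[π_op]`. -/
def perturb {S A : Type*} [Fintype A] (T : S → A → S → ℝ) (πop : S → A → ℝ) (α : ℝ) :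
    S → A → S → ℝ :=
  fun s a s' => α * T s a s' + (1 - α) * ∑ b, πop s b * T s b s'

/-- The mixed policy `α·π_pl + (1−α)·π_op`. -/
def mix {S A : Type*} (πpl πop : S → A → ℝ) (α : ℝ) : S → A → ℝ :=
  fun s a => α * πpl s a + (1 - α) * πop s a

/-- The probability of a length-`N+1` state trajectory under initial distribution `P0`,
policy `π` and kernel `U`:
`P0 (τ 0) · ∏_{t=0}^{N-1} ∑_a π (τ t) a · U (τ t) a (τ (t+1))`. -/
def trajProb {S A : Type*} [Fintype A] (P0 : S → ℝ) (π : S → A → ℝ) (U : S → A → S → ℝ)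
    (N : ℕ) (τ : Fin (N + 1) → S) : ℝ :=
  P0 (τ 0) * ∏ t : Fin N, ∑ a, π (τ t.castSucc) a * U (τ t.castSucc) a (τ t.succ)

/-- The trajectory distribution induced by the player policy under the perturbed kernel
coincides with that induced by the mixed policy under the original kernel. -/
theorem trajProb_equivalence {S A : Type*} [Fintype S] [Fintype A] [Nonempty S] [Nonempty A]
    (T : S → A → S → ℝ) (hT : IsKernel T)
    (P0 : S → ℝ) (hP0 : IsDist P0)
    (πpl πop : S → A → ℝ) (hpl : IsPolicy πpl) (hop : IsPolicy πop)
    (α : ℝ) (hα : α ∈ Set.Icc (0 : ℝ) 1)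
    (N : ℕ) (τ : Fin (N + 1) → S) :
    trajProb P0 πpl (perturb T πop α) N τ = trajProb P0 (mix πpl πop α) T N τ := by
  unfold trajProb
  congr 1
  refine Finset.prod_congr rfl fun t _ => ?_
  have h1 := hpl.2 (τ t.castSucc)
  simp only [perturb, mix, mul_add, add_mul, Finset.sum_add_distrib]
  rw [← Finset.sum_mul, h1, one_mul, Finset.mul_sum]
  congr 1
  · exact Finset.sum_congr rfl fun a _ => by ring
  · exact Finset.sum_congr rfl fun a _ => by ring
end

section
/- For every pair of policies π_pl, π_op, every α ∈ [0,1], every horizon N ∈ ℕ, and every function f : S^{N+1} → ℝ, the expectations of f under the two trajectory distributions coincide: ∑_{τ ∈ S^{N+1}} f(τ) · P^{π_pl, T^α[π_op]}_N(τ) = ∑_{τ ∈ S^{N+1}} f(τ) · P^{π_mix, T}_N(τ). -/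
open Finset

/-- The expectation of any trajectory functional `f` is the same under the two trajectory
distributions. -/
theorem expectation_equivalence {S A : Type*} [Fintype S] [Fintype A] [Nonempty S] [Nonempty A]
    (T : S → A → S → ℝ) (hT : IsKernel T)
    (P0 : S → ℝ) (hP0 : IsDist P0)
    (πpl πop : S → A → ℝ) (hpl : IsPolicy πpl) (hop : IsPolicy πop)
    (α : ℝ) (hα : α ∈ Set.Icc (0 : ℝ) 1)
    (N : ℕ) (f : (Fin (N + 1) → S) → ℝ) :
    ∑ τ : Fin (N + 1) → S, f τ * trajProb P0 πpl (perturb T πop α) N τ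
      = ∑ τ : Fin (N + 1) → S, f τ * trajProb P0 (mix πpl πop α) T N τ := by
  have key : ∀ s s', ∑ a, πpl s a * perturb T πop α s a s' = ∑ a, mix πpl πop α s a * T s a s' := by
    intro s s'
    simp only [perturb, mix, mul_add, add_mul, Finset.sum_add_distrib]
    rw [← Finset.sum_mul, hpl.2 s, one_mul, Finset.mul_sum]
    congr 1
    · exact Finset.sum_congr rfl fun a _ => by ring
    · exact Finset.sum_congr rfl fun a _ => by ring
  simp only [trajProb, key]
end

section
/- For every pair of policies π_pl, π_op, every α ∈ [0,1], every horizon N ∈ ℕ, every cost c : S × S → ℝ, and every γ ∈ ℝ, the expected finite-horizon discounted cost is the same under the two processes: ∑_{τ ∈ S^{N+1}} P^{π_pl, T^α[π_op]}_N(τ) · (∑_{t=0}^{N−1} γ^t · c(s_t, s_{t+1})) = ∑_{τ ∈ S^{N+1}} P^{π_mix, T}_N(τ) · (∑_{t=0}^{N−1} γ^t · c(s_t, s_{t+1})), where τ = (s_0, …, s_N). -/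
open Finset

/-- The expected finite-horizon discounted cost is the same under the two processes. -/
theorem discounted_cost_equivalence {S A : Type*} [Fintype S] [Fintype A] [Nonempty S] [Nonempty A]
    (T : S → A → S → ℝ) (hT : IsKernel T)
    (P0 : S → ℝ) (hP0 : IsDist P0)
    (πpl πop : S → A → ℝ) (hpl : IsPolicy πpl) (hop : IsPolicy πop)
    (α : ℝ) (hα : α ∈ Set.Icc (0 : ℝ) 1)
    (N : ℕ) (c : S × S → ℝ) (γ : ℝ) :
    ∑ τ : Fin (N + 1) → S, trajProb P0 πpl (perturb T πop α) N τ *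
        (∑ t : Fin N, γ ^ (t : ℕ) * c (τ t.castSucc, τ t.succ))
      = ∑ τ : Fin (N + 1) → S, trajProb P0 (mix πpl πop α) T N τ *
        (∑ t : Fin N, γ ^ (t : ℕ) * c (τ t.castSucc, τ t.succ)) := by
  refine Finset.sum_congr rfl fun τ _ => ?_
  have key : ∀ s s', ∑ a, πpl s a * perturb T πop α s a s'
      = ∑ a, mix πpl πop α s a * T s a s' := by
    intro s s'
    simp only [perturb, mix, mul_add, add_mul, Finset.sum_add_distrib]
    rw [← Finset.sum_mul, hpl.2 s, one_mul, Finset.mul_sum]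
    congr 1
    · exact Finset.sum_congr rfl fun a _ => by ring
    · exact Finset.sum_congr rfl fun a _ => by ring
  simp only [trajProb, key]
end

section
/- For every pair of policies π_pl, π_op, every α ∈ [0,1], every horizon N ∈ ℕ, every cost c : S × S → ℝ, and every γ ∈ ℝ, the expected finite-horizon entropy-regularized discounted return is the same under the two processes: ∑_{τ ∈ S^{N+1}} P^{π_pl, T^α[π_op]}_N(τ) · (∑_{t=0}^{N−1} γ^t · (c(s_t, s_{t+1}) − H(π_pl s_t))) = ∑_{τ ∈ S^{N+1}} P^{π_mix, T}_N(τ) · (∑_{t=0}^{N−1} γ^t · (c(s_t, s_{t+1}) − H(π_pl s_t))), where τ = (s_0, …, s_N). -/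
open Finset

/-- Shannon entropy of a finitely supported action distribution, with the convention
`0 · log 0 = 0` (which holds since `Real.log 0 = 0`). -/
noncomputable def shannonEntropy {A : Type*} [Fintype A] (p : A → ℝ) : ℝ :=
  -∑ a, p a * Real.log (p a)

/-- The expected finite-horizon entropy-regularized discounted return is the same under the
two processes. -/
theorem entropy_regularized_return_equivalence
    {S A : Type*} [Fintype S] [Fintype A] [Nonempty S] [Nonempty A]
    (T : S → A → S → ℝ) (hT : IsKernel T)
    (P0 : S → ℝ) (hP0 : IsDist P0)
    (πpl πop : S → A → ℝ) (hpl : IsPolicy πpl) (hop : IsPolicy πop)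
    (α : ℝ) (hα : α ∈ Set.Icc (0 : ℝ) 1)
    (N : ℕ) (c : S × S → ℝ) (γ : ℝ) :
    ∑ τ : Fin (N + 1) → S, trajProb P0 πpl (perturb T πop α) N τ *
        (∑ t : Fin N, γ ^ (t : ℕ) *
          (c (τ t.castSucc, τ t.succ) - shannonEntropy (πpl (τ t.castSucc))))
      = ∑ τ : Fin (N + 1) → S, trajProb P0 (mix πpl πop α) T N τ *
        (∑ t : Fin N, γ ^ (t : ℕ) *
          (c (τ t.castSucc, τ t.succ) - shannonEntropy (πpl (τ t.castSucc)))) := by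
  have key : ∀ s s', ∑ a, πpl s a * perturb T πop α s a s'
      = ∑ a, mix πpl πop α s a * T s a s' := by
    intro s s'
    simp only [perturb, mix, mul_add, add_mul, Finset.sum_add_distrib]
    rw [← Finset.sum_mul, hpl.2 s, one_mul, Finset.mul_sum]
    congr 1
    · exact Finset.sum_congr rfl fun a _ => by ring
    · exact Finset.sum_congr rfl fun a _ => by ring
  simp only [trajProb, key]
end

section
/- For every pair of policies π_pl, π_op, every α ∈ [0,1], every t ∈ ℕ, and every state s ∈ S, the time-t state marginals coincide: p^{π_pl, T^α[π_op]}_t(s) = p^{π_mix, T}_t(s). -/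
open Finset

/-- The time-`t` state marginal of the Markov chain induced by policy `π` and kernel `U`
started at `P0`. -/
def marg {S A : Type*} [Fintype S] [Fintype A] (P0 : S → ℝ) (π : S → A → ℝ)
    (U : S → A → S → ℝ) : ℕ → S → ℝ
  | 0 => P0
  | t + 1 => fun s' => ∑ s, marg P0 π U t s * ∑ a, π s a * U s a s'

/-- The time-`t` state marginals coincide under the two processes. -/
theorem marginal_equivalence {S A : Type*} [Fintype S] [Fintype A] [Nonempty S] [Nonempty A]
    (T : S → A → S → ℝ) (hT : IsKernel T)
    (P0 : S → ℝ) (hP0 : IsDist P0)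
    (πpl πop : S → A → ℝ) (hpl : IsPolicy πpl) (hop : IsPolicy πop)
    (α : ℝ) (hα : α ∈ Set.Icc (0 : ℝ) 1)
    (t : ℕ) (s : S) :
    marg P0 πpl (perturb T πop α) t s = marg P0 (mix πpl πop α) T t s := by
  induction t generalizing s with
  | zero => rfl
  | succ t ih =>
    simp only [marg]
    refine Finset.sum_congr rfl fun x _ => ?_
    rw [ih x]
    congr 1
    simp only [perturb, mix, mul_add, add_mul, Finset.sum_add_distrib]
    rw [← Finset.sum_mul, hpl.2 x, one_mul, Finset.mul_sum]
    congr 1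
    · exact Finset.sum_congr rfl fun a _ => by ring
    · exact Finset.sum_congr rfl fun a _ => by ring
end

section
/- For every pair of policies π_pl, π_op, every α ∈ [0,1], every t ∈ ℕ, and all states s, s' ∈ S, the time-t joint distribution of consecutive state pairs coincides under the two processes: p^{π_pl, T^α[π_op]}_t(s) · ∑_{a∈A} π_pl s a · T^α[π_op] s a s' = p^{π_mix, T}_t(s) · ∑_{a∈A} π_mix s a · T s a s'. -/
open Finset

/-- The time-`t` joint distribution of consecutive state pairs coincides under the two
processes. -/
theorem joint_equivalence {S A : Type*} [Fintype S] [Fintype A] [Nonempty S] [Nonempty A]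
    (T : S → A → S → ℝ) (hT : IsKernel T)
    (P0 : S → ℝ) (hP0 : IsDist P0)
    (πpl πop : S → A → ℝ) (hpl : IsPolicy πpl) (hop : IsPolicy πop)
    (α : ℝ) (hα : α ∈ Set.Icc (0 : ℝ) 1)
    (t : ℕ) (s s' : S) :
    marg P0 πpl (perturb T πop α) t s * ∑ a, πpl s a * perturb T πop α s a s'
      = marg P0 (mix πpl πop α) T t s * ∑ a, mix πpl πop α s a * T s a s' := by
  have key : ∀ s s', ∑ a, πpl s a * perturb T πop α s a s'
      = ∑ a, mix πpl πop α s a * T s a s' := by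
    intro s s'
    have h1 : ∑ a, πpl s a * perturb T πop α s a s'
        = α * ∑ a, πpl s a * T s a s'
          + (∑ a, πpl s a) * ((1 - α) * ∑ b, πop s b * T s b s') := by
      rw [Finset.mul_sum, Finset.sum_mul, ← Finset.sum_add_distrib]
      refine Finset.sum_congr rfl fun a _ => ?_
      simp only [perturb]
      ring
    rw [h1, hpl.2 s, one_mul, Finset.mul_sum, Finset.mul_sum, ← Finset.sum_add_distrib]
    refine Finset.sum_congr rfl fun a _ => ?_
    simp only [mix]
    ring
  have hm : ∀ t s, marg P0 πpl (perturb T πop α) t s = marg P0 (mix πpl πop α) T t s := by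
    intro t
    induction t with
    | zero => intro s; rfl
    | succ t ih =>
      intro s
      simp only [marg]
      refine Finset.sum_congr rfl fun x _ => ?_
      rw [ih, key]
  rw [hm, key]
end

section
/- Let γ ∈ (0,1). For every policy π and transition kernel U, the series defining the state-transition occupancy measure ρ^{π,U}(s,s') converges absolutely for all s, s' ∈ S; moreover, for every pair of policies π_pl, π_op and every α ∈ [0,1], ρ^{π_pl, T^α[π_op]}(s,s') = ρ^{π_mix, T}(s,s') for all s, s' ∈ S. -/
open Finset

theorem step_eq {S A : Type*} [Fintype A] (T : S → A → S → ℝ) (πpl πop : S → A → ℝ)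
    (hpl : IsPolicy πpl) (α : ℝ) (s s' : S) :
    ∑ a, πpl s a * perturb T πop α s a s' = ∑ a, mix πpl πop α s a * T s a s' := by
  simp only [perturb, mix, mul_add, add_mul, Finset.sum_add_distrib]
  rw [← Finset.sum_mul, hpl.2 s, one_mul, Finset.mul_sum]
  congr 1
  · exact Finset.sum_congr rfl fun a _ => by ring
  · exact Finset.sum_congr rfl fun a _ => by ring

theorem marg_eq {S A : Type*} [Fintype S] [Fintype A] (T : S → A → S → ℝ) (P0 : S → ℝ)
    (πpl πop : S → A → ℝ) (hpl : IsPolicy πpl) (α : ℝ) (t : ℕ) :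
    marg P0 πpl (perturb T πop α) t = marg P0 (mix πpl πop α) T t := by
  induction t with
  | zero => rfl
  | succ t ih =>
    funext s'
    simp only [marg, ih, step_eq T πpl πop hpl α]

theorem step_sum {S A : Type*} [Fintype S] [Fintype A] (π : S → A → ℝ) (U : S → A → S → ℝ)
    (hπ : IsPolicy π) (hU : IsKernel U) (s : S) : ∑ s', ∑ a, π s a * U s a s' = 1 := by
  rw [Finset.sum_comm]
  simp only [← Finset.mul_sum, hU.2, mul_one, hπ.2]

theorem step_nonneg {S A : Type*} [Fintype S] [Fintype A] (π : S → A → ℝ) (U : S → A → S → ℝ)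
    (hπ : IsPolicy π) (hU : IsKernel U) (s s' : S) : 0 ≤ ∑ a, π s a * U s a s' :=
  Finset.sum_nonneg fun a _ => mul_nonneg (hπ.1 s a) (hU.1 s a s')

theorem marg_dist {S A : Type*} [Fintype S] [Fintype A] (P0 : S → ℝ) (hP0 : IsDist P0)
    (π : S → A → ℝ) (U : S → A → S → ℝ)
    (hπ : IsPolicy π) (hU : IsKernel U) (t : ℕ) : IsDist (marg P0 π U t) := by
  induction t with
  | zero => exact hP0
  | succ t ih =>
    refine ⟨fun s' => Finset.sum_nonneg fun s _ =>
      mul_nonneg (ih.1 s) (step_nonneg π U hπ hU s s'), ?_⟩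
    simp only [marg]
    rw [Finset.sum_comm]
    simp only [← Finset.mul_sum, step_sum π U hπ hU, mul_one, ih.2]

theorem dist_le_one {S : Type*} [Fintype S] (p : S → ℝ) (hp : IsDist p) (s : S) : p s ≤ 1 :=
  hp.2 ▸ Finset.single_le_sum (fun i _ => hp.1 i) (Finset.mem_univ s)

/-- The series defining the state-transition occupancy measure converges absolutely, and the
occupancy measures of the player policy under the perturbed kernel and of the mixed policy
under the original kernel coincide. -/
theorem occupancy_equivalence {S A : Type*} [Fintype S] [Fintype A] [Nonempty S] [Nonempty A]
    (T : S → A → S → ℝ) (hT : IsKernel T)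
    (P0 : S → ℝ) (hP0 : IsDist P0)
    (γ : ℝ) (hγ : γ ∈ Set.Ioo (0 : ℝ) 1) :
    (∀ (π : S → A → ℝ) (U : S → A → S → ℝ), IsPolicy π → IsKernel U → ∀ s s' : S,
        Summable (fun t : ℕ => |γ ^ t * marg P0 π U t s * ∑ a, π s a * U s a s'|)) ∧
      ∀ (πpl πop : S → A → ℝ), IsPolicy πpl → IsPolicy πop →
        ∀ α ∈ Set.Icc (0 : ℝ) 1, ∀ s s' : S,
          (∑' t : ℕ, γ ^ t * marg P0 πpl (perturb T πop α) t s *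
              ∑ a, πpl s a * perturb T πop α s a s')
            = ∑' t : ℕ, γ ^ t * marg P0 (mix πpl πop α) T t s *
              ∑ a, mix πpl πop α s a * T s a s' := by
  refine ⟨fun π U hπ hU s s' => ?_, fun πpl πop hpl _ α _ s s' => ?_⟩
  · have hk := step_nonneg π U hπ hU s s'
    refine Summable.of_nonneg_of_le (fun _ => abs_nonneg _) (fun t => ?_)
      ((summable_geometric_of_lt_one hγ.1.le hγ.2).mul_right (∑ a, π s a * U s a s'))
    have hm := marg_dist P0 hP0 π U hπ hU t
    have hg : 0 ≤ γ ^ t := pow_nonneg hγ.1.le t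
    rw [abs_of_nonneg (mul_nonneg (mul_nonneg hg (hm.1 s)) hk)]
    exact mul_le_mul_of_nonneg_right (mul_le_of_le_one_right hg (dist_le_one _ hm s)) hk
  · simp only [marg_eq T P0 πpl πop hpl α, step_eq T πpl πop hpl α]
end
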